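/- Let φ : M_m(ℂ) → M_n(ℂ) be a positive linear map which is nondecomposable, i.e. φ is not the sum of a completely positive map and a copositive map. Then there exists a positive semidefinite h ∈ M_n(ℂ) ⊗ M_m(ℂ) with Tr(h) = 1 such that (t ⊗ ι)(h) is positive semidefinite, (ι ⊗ φ)(h) is not positive semidefinite, and the state ρ(x) = Tr(h x) is entangled (not separable) but satisfies the Peres condition. -/

import Mathlib

open Matrix
open scoped ComplexOrder Kronecker

/-- The map `ι_k ⊗ φ` applied blockwise to a matrix in `M_k(ℂ) ⊗ M_n(ℂ)`. -/
def idTensor {n m : ℕ} (k : ℕ)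
    (φ : Matrix (Fin n) (Fin n) ℂ →ₗ[ℂ] Matrix (Fin m) (Fin m) ℂ)
    (x : Matrix (Fin k × Fin n) (Fin k × Fin n) ℂ) :
    Matrix (Fin k × Fin m) (Fin k × Fin m) ℂ :=
  Matrix.of fun p q => φ (Matrix.of fun a b => x (p.1, a) (q.1, b)) p.2 q.2

/-- A linear map `φ : M_n(ℂ) → M_m(ℂ)` is completely positive if `ι_k ⊗ φ` maps positive
semidefinite matrices to positive semidefinite matrices for every `k`. -/
def IsCompletelyPositive {n m : ℕ}
    (φ : Matrix (Fin n) (Fin n) ℂ →ₗ[ℂ] Matrix (Fin m) (Fin m) ℂ) : Prop :=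
  ∀ (k : ℕ) (x : Matrix (Fin k × Fin n) (Fin k × Fin n) ℂ),
    x.PosSemidef → (idTensor k φ x).PosSemidef

/-- The transpose map on `M_m(ℂ)` as a linear map. -/
def transposeLM (m : ℕ) : Matrix (Fin m) (Fin m) ℂ →ₗ[ℂ] Matrix (Fin m) (Fin m) ℂ where
  toFun x := xᵀ
  map_add' x y := by ext i j; simp
  map_smul' c x := by ext i j; simp

/-- A linear map `φ` is copositive if `t ∘ φ` is completely positive. -/
def IsCopositive {n m : ℕ}
    (φ : Matrix (Fin n) (Fin n) ℂ →ₗ[ℂ] Matrix (Fin m) (Fin m) ℂ) : Prop :=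
  IsCompletelyPositive (transposeLM m ∘ₗ φ)

/-- A linear map is decomposable if it is the sum of a completely positive map and a
copositive map. -/
def IsDecomposable {n m : ℕ}
    (φ : Matrix (Fin n) (Fin n) ℂ →ₗ[ℂ] Matrix (Fin m) (Fin m) ℂ) : Prop :=
  ∃ φ₁ φ₂ : Matrix (Fin n) (Fin n) ℂ →ₗ[ℂ] Matrix (Fin m) (Fin m) ℂ,
    IsCompletelyPositive φ₁ ∧ IsCopositive φ₂ ∧ φ = φ₁ + φ₂

/-- The map `ι ⊗ ψ` applied blockwise to a matrix in `M_n(ℂ) ⊗ M_m(ℂ)`, where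
`ψ : M_m(ℂ) → M_p(ℂ)` acts on the second tensor factor. -/
def mapRight {n m p : ℕ}
    (ψ : Matrix (Fin m) (Fin m) ℂ →ₗ[ℂ] Matrix (Fin p) (Fin p) ℂ)
    (h : Matrix (Fin n × Fin m) (Fin n × Fin m) ℂ) :
    Matrix (Fin n × Fin p) (Fin n × Fin p) ℂ :=
  Matrix.of fun q r => ψ (Matrix.of fun s t => h (q.1, s) (r.1, t)) q.2 r.2

/-- The partial transpose `ι ⊗ t` on `M_n(ℂ) ⊗ M_m(ℂ)`, transposing the second factor. -/
def ptRight (n m : ℕ) (x : Matrix (Fin n × Fin m) (Fin n × Fin m) ℂ) :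
    Matrix (Fin n × Fin m) (Fin n × Fin m) ℂ :=
  Matrix.of fun p q => x (p.1, q.2) (q.1, p.2)

/-- The partial transpose `t ⊗ ι` on `M_n(ℂ) ⊗ M_m(ℂ)`, transposing the first factor. -/
def ptLeft (n m : ℕ) (x : Matrix (Fin n × Fin m) (Fin n × Fin m) ℂ) :
    Matrix (Fin n × Fin m) (Fin n × Fin m) ℂ :=
  Matrix.of fun p q => x (q.1, p.2) (p.1, q.2)

theorem Matrix.PosSemidef.norm_apply_le_re_trace {ι : Type*} [Fintype ι]
    {A : Matrix ι ι ℂ} (hA : A.PosSemidef) (i j : ι) : ‖A i j‖ ≤ A.trace.re := by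
  have hdiag : ∀ i, 0 ≤ (A i i).re := fun i => (Complex.le_def.1 (hA.diag_nonneg (i := i))).1
  have hle : ∀ i, (A i i).re ≤ A.trace.re := fun i => by
    simpa [Matrix.trace] using
      Finset.single_le_sum (f := fun i => (A i i).re) (fun i _ => hdiag i) (Finset.mem_univ i)
  have hdet := (hA.submatrix ![i, j]).det_nonneg
  have hji : A j i = star (A i j) := (hA.1.apply j i).symm
  have him : (A i i).im = 0 := (Complex.le_def.1 (hA.diag_nonneg (i := i))).2.symm
  have hre := (Complex.le_def.1 hdet).1
  simp only [Matrix.det_fin_two, Matrix.submatrix_apply, Matrix.cons_val_zero,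
    Matrix.cons_val_one, hji] at hre
  simp [him] at hre
  have hsq : ‖A i j‖ ^ 2 = (A i j).re * (A i j).re + (A i j).im * (A i j).im := by
    rw [← Complex.normSq_eq_norm_sq, Complex.normSq_apply]
  have h1 := mul_le_mul (hle i) (hle j) (hdiag j) ((hdiag i).trans (hle i))
  refine abs_le_of_sq_le_sq' ?_ ((hdiag i).trans (hle i)) |>.2
  nlinarith

theorem Matrix.isClosed_setOf_posSemidef {ι : Type*} [Fintype ι] :
    IsClosed {A : Matrix ι ι ℂ | A.PosSemidef} := by
  simp only [Matrix.posSemidef_iff_dotProduct_mulVec, Set.ofPred_and, Set.ofPred_forall]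
  refine IsClosed.inter (isClosed_eq (by fun_prop) (by fun_prop)) (isClosed_iInter fun x => ?_)
  exact isClosed_le (by fun_prop) (by fun_prop)

theorem Matrix.isCompact_setOf_posSemidef_re_trace_le {ι : Type*} [Fintype ι] (c : ℝ) :
    IsCompact {A : Matrix ι ι ℂ | A.PosSemidef ∧ A.trace.re ≤ c} := by
  have hK : IsCompact {A : Matrix ι ι ℂ | ∀ i, A i ∈ {v : ι → ℂ | ∀ j, v j ∈
      Metric.closedBall (0 : ℂ) c}} :=
    isCompact_pi_infinite fun _ => isCompact_pi_infinite fun _ => isCompact_closedBall _ _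
  refine hK.of_isClosed_subset ?_ ?_
  · have hle : IsClosed {A : Matrix ι ι ℂ | A.trace.re ≤ c} :=
      isClosed_le (Complex.continuous_re.comp (by fun_prop)) continuous_const
    exact Matrix.isClosed_setOf_posSemidef.inter hle
  · intro A hA i j
    simpa using (hA.1.norm_apply_le_re_trace i j).trans hA.2

theorem ptLeft_add {n m : ℕ} (A B : Matrix (Fin n × Fin m) (Fin n × Fin m) ℂ) :
    ptLeft n m (A + B) = ptLeft n m A + ptLeft n m B := rfl

theorem trace_ptLeft {n m : ℕ} (A : Matrix (Fin n × Fin m) (Fin n × Fin m) ℂ) :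
    (ptLeft n m A).trace = A.trace := rfl

theorem continuous_ptLeft {n m : ℕ} : Continuous (ptLeft n m) :=
  continuous_matrix fun _ _ => continuous_id.matrix_elem _ _

/-- The sums of a positive semidefinite matrix and a matrix with positive semidefinite partial
transpose. -/
def decomposableMatrices (n m : ℕ) : Set (Matrix (Fin n × Fin m) (Fin n × Fin m) ℂ) :=
  {X | ∃ A B : Matrix (Fin n × Fin m) (Fin n × Fin m) ℂ,
    A.PosSemidef ∧ B.PosSemidef ∧ X = A + ptLeft n m B}

theorem isClosed_decomposableMatrices (n m : ℕ) : IsClosed (decomposableMatrices n m) := by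
  refine isClosed_of_closure_subset fun X hX => ?_
  set c : ℝ := X.trace.re + 1
  let S := {A : Matrix (Fin n × Fin m) (Fin n × Fin m) ℂ | A.PosSemidef ∧ A.trace.re ≤ c}
  have hS : IsCompact S := Matrix.isCompact_setOf_posSemidef_re_trace_le c
  have himg : IsCompact (Set.image (fun p : Matrix (Fin n × Fin m) (Fin n × Fin m) ℂ ×
      Matrix (Fin n × Fin m) (Fin n × Fin m) ℂ => p.1 + ptLeft n m p.2) (S ×ˢ S)) :=
    (hS.prod hS).image (continuous_fst.add (continuous_ptLeft.comp continuous_snd))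
  have hU : IsOpen {Y : Matrix (Fin n × Fin m) (Fin n × Fin m) ℂ | Y.trace.re < c} :=
    isOpen_lt (Complex.continuous_re.comp (by fun_prop)) continuous_const
  have hmem : X ∈ closure ({Y : Matrix (Fin n × Fin m) (Fin n × Fin m) ℂ | Y.trace.re < c} ∩
      decomposableMatrices n m) :=
    hU.inter_closure ⟨lt_add_one X.trace.re, hX⟩
  obtain ⟨⟨A, B⟩, ⟨hA, hB⟩, rfl⟩ := closure_minimal (fun Y hY => by
    obtain ⟨hlt, A, B, hA, hB, rfl⟩ := hY
    have h1 := (Complex.le_def.1 hA.trace_nonneg).1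
    have h2 := (Complex.le_def.1 hB.trace_nonneg).1
    simp only [Set.mem_ofPred_eq, Matrix.trace_add, trace_ptLeft, Complex.add_re,
      Complex.zero_re] at hlt h1 h2
    exact ⟨(A, B), ⟨⟨hA, by linarith⟩, ⟨hB, by linarith⟩⟩, rfl⟩) himg.isClosed hmem
  exact ⟨A, B, hA.1, hB.1, rfl⟩

/-- The closed convex cone of decomposable matrices. -/
def decomposableCone (n m : ℕ) :
    ProperCone ℝ (Matrix (Fin n × Fin m) (Fin n × Fin m) ℂ) where
  carrier := decomposableMatrices n m
  add_mem' := by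
    rintro _ _ ⟨A, B, hA, hB, rfl⟩ ⟨A', B', hA', hB', rfl⟩
    exact ⟨A + A', B + B', hA.add hA', hB.add hB', by rw [ptLeft_add]; abel⟩
  zero_mem' := ⟨0, 0, .zero, .zero, by ext; simp [ptLeft]⟩
  smul_mem' := by
    rintro ⟨c, hc⟩ _ ⟨A, B, hA, hB, rfl⟩
    exact ⟨c • A, c • B, hA.smul hc, hB.smul hc, by ext; simp [ptLeft]⟩
  isClosed' := isClosed_decomposableMatrices n m

/-- Every real functional on complex matrices agrees, up to a factor, on Hermitian matrices with
the pairing against a Hermitian matrix. -/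
theorem exists_isHermitian_re_sum_mul_eq {ι : Type*} [Fintype ι] [DecidableEq ι]
    (f : Matrix ι ι ℂ →ₗ[ℝ] ℝ) :
    ∃ h : Matrix ι ι ℂ, h.IsHermitian ∧
      ∀ x : Matrix ι ι ℂ, x.IsHermitian → (∑ p, ∑ q, h p q * x p q).re = 2 * f x := by
  let g : Matrix ι ι ℂ := Matrix.of fun p q =>
    (f (Matrix.single p q 1) : ℂ) - f (Matrix.single p q Complex.I) * Complex.I
  have hg : ∀ x : Matrix ι ι ℂ, (∑ p, ∑ q, g p q * x p q).re = f x := fun x => by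
    conv_rhs => rw [Matrix.matrix_eq_sum_single x]
    simp only [map_sum, Complex.re_sum]
    refine Finset.sum_congr rfl fun p _ => Finset.sum_congr rfl fun q _ => ?_
    have : Matrix.single p q (x p q) = (x p q).re • Matrix.single p q (1 : ℂ) +
        (x p q).im • Matrix.single p q Complex.I := by
      rw [Matrix.smul_single, Matrix.smul_single, ← Matrix.single_add]
      congr 1
      apply Complex.ext <;> simp
    rw [this, map_add, map_smul, map_smul]
    simp [g]
    ring
  refine ⟨g + gᴴ, Matrix.isHermitian_add_transpose_self g, fun x hx => ?_⟩
  have hstar : ∑ p, ∑ q, gᴴ p q * x p q = star (∑ p, ∑ q, g p q * x p q) := by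
    rw [Finset.sum_comm]
    simp only [star_sum, star_mul', Matrix.conjTranspose_apply, hx.apply]
  have hre := congrArg Complex.re hstar
  simp only [Complex.star_def, Complex.conj_re, hg] at hre
  simp only [Matrix.add_apply, add_mul, Finset.sum_add_distrib, Complex.add_re, hg, hre]
  ring

theorem Matrix.posSemidef_of_re_sum_mul_nonneg {ι : Type*} [Fintype ι] {h : Matrix ι ι ℂ}
    (hh : h.IsHermitian)
    (hx : ∀ x : Matrix ι ι ℂ, x.PosSemidef → 0 ≤ (∑ p, ∑ q, h p q * x p q).re) :
    h.PosSemidef := by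
  refine .of_dotProduct_mulVec_nonneg hh fun v => Complex.le_def.2 ⟨?_, ?_⟩
  · have hsum : star v ⬝ᵥ (h *ᵥ v) = ∑ p, ∑ q, h p q * Matrix.vecMulVec (star v) v p q := by
      simp only [dotProduct, Matrix.mulVec, Finset.mul_sum, Matrix.vecMulVec_apply]
      exact Finset.sum_congr rfl fun p _ => Finset.sum_congr rfl fun q _ => by ring
    rw [hsum]
    exact hx _ (Matrix.posSemidef_vecMulVec_star_self v)
  · simpa using (hh.im_star_dotProduct_mulVec_self v).symm

theorem sum_ptLeft_mul {n m : ℕ} (h x : Matrix (Fin n × Fin m) (Fin n × Fin m) ℂ) :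
    ∑ p, ∑ q, ptLeft n m h p q * x p q = ∑ p, ∑ q, h p q * ptLeft n m x p q := by
  simp only [ptLeft, Matrix.of_apply, Fintype.sum_prod_type]
  rw [Finset.sum_comm]
  conv_rhs => rw [Finset.sum_comm]
  exact Finset.sum_congr rfl fun s _ => Finset.sum_comm

/-- Duality between decomposable matrices and matrices with positive partial transpose. -/
theorem exists_ppt_re_sum_mul_neg {n m : ℕ} {D : Matrix (Fin n × Fin m) (Fin n × Fin m) ℂ}
    (hD : D.IsHermitian) (hnd : D ∉ decomposableMatrices n m) :
    ∃ h : Matrix (Fin n × Fin m) (Fin n × Fin m) ℂ, h.PosSemidef ∧ (ptLeft n m h).PosSemidef ∧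
      (∑ p, ∑ q, h p q * D p q).re < 0 := by
  have : LocallyConvexSpace ℝ (Matrix (Fin n × Fin m) (Fin n × Fin m) ℂ) :=
    inferInstanceAs (LocallyConvexSpace ℝ (Fin n × Fin m → Fin n × Fin m → ℂ))
  obtain ⟨f, hf, hfD⟩ := (decomposableCone n m).hyperplane_separation_point (x₀ := D) hnd
  obtain ⟨h, hh, hhf⟩ := exists_isHermitian_re_sum_mul_eq f.toLinearMap
  have hpt : ∀ {x : Matrix (Fin n × Fin m) (Fin n × Fin m) ℂ}, x.IsHermitian →
      (ptLeft n m x).IsHermitian := fun {x} hx => by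
    ext p q
    simpa [ptLeft] using hx.apply (q.1, p.2) (p.1, q.2)
  refine ⟨h, Matrix.posSemidef_of_re_sum_mul_nonneg hh fun x hx => ?_,
    Matrix.posSemidef_of_re_sum_mul_nonneg (hpt hh) fun x hx => ?_, ?_⟩
  · rw [hhf x hx.1]
    exact mul_nonneg two_pos.le (hf x ⟨x, 0, hx, .zero, by ext; simp [ptLeft]⟩)
  · rw [sum_ptLeft_mul, hhf _ (hpt hx.1)]
    exact mul_nonneg two_pos.le (hf _ ⟨0, x, .zero, hx, by simp⟩)
  · rw [hhf D hD]
    exact mul_neg_of_pos_of_neg two_pos hfD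

/-- The linear map with Choi matrix `A`. -/
def ofChoi {n m : ℕ} (A : Matrix (Fin n × Fin m) (Fin n × Fin m) ℂ) :
    Matrix (Fin m) (Fin m) ℂ →ₗ[ℂ] Matrix (Fin n) (Fin n) ℂ where
  toFun x := Matrix.of fun i j => ∑ s, ∑ t, x s t * A (i, s) (j, t)
  map_add' x y := by ext i j; simp [add_mul, Finset.sum_add_distrib]
  map_smul' c x := by ext i j; simp [Finset.mul_sum, mul_assoc]

theorem isCompletelyPositive_ofChoi {n m : ℕ}
    {A : Matrix (Fin n × Fin m) (Fin n × Fin m) ℂ} (hA : A.PosSemidef) :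
    IsCompletelyPositive (ofChoi A) := fun k x hx => by
  let P := (x.kronecker A).submatrix
    (fun r : (Fin k × Fin n) × Fin m => ((r.1.1, r.2), (r.1.2, r.2)))
    (fun r : (Fin k × Fin n) × Fin m => ((r.1.1, r.2), (r.1.2, r.2)))
  let L : Matrix (Fin k × Fin n) ((Fin k × Fin n) × Fin m) ℂ :=
    Matrix.of fun p r => if p = r.1 then 1 else 0
  have hP : P.PosSemidef := (hx.kronecker hA).submatrix _
  convert hP.mul_mul_conjTranspose_same L using 1
  ext p q
  simp only [Matrix.mul_apply, Fintype.sum_prod_type (α₁ := Fin k × Fin n)]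
  simp [idTensor, ofChoi, L, P, apply_ite, Finset.sum_ite_eq]
  rw [Finset.sum_comm]

theorem isCopositive_ofChoi_ptLeft {n m : ℕ}
    {B : Matrix (Fin n × Fin m) (Fin n × Fin m) ℂ} (hB : B.PosSemidef) :
    IsCopositive (ofChoi (ptLeft n m B)) :=
  isCompletelyPositive_ofChoi hB

/-- The Choi matrix of `φ`, with the output factor first. -/
def choi {n m : ℕ} (φ : Matrix (Fin m) (Fin m) ℂ →ₗ[ℂ] Matrix (Fin n) (Fin n) ℂ) :
    Matrix (Fin n × Fin m) (Fin n × Fin m) ℂ :=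
  Matrix.of fun p q => φ (Matrix.single p.2 q.2 1) p.1 q.1

theorem map_apply_eq_sum {n m : ℕ}
    (φ : Matrix (Fin m) (Fin m) ℂ →ₗ[ℂ] Matrix (Fin n) (Fin n) ℂ)
    (x : Matrix (Fin m) (Fin m) ℂ) (i j : Fin n) :
    φ x i j = ∑ s, ∑ t, x s t * choi φ (i, s) (j, t) := by
  conv_lhs => rw [Matrix.matrix_eq_sum_single x]
  simp only [map_sum, Matrix.sum_apply]
  refine Finset.sum_congr rfl fun s _ => Finset.sum_congr rfl fun t _ => ?_
  rw [← mul_one (x s t), ← smul_eq_mul, ← Matrix.smul_single, map_smul]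
  simp [choi]

theorem isDecomposable_of_choi_mem {n m : ℕ}
    {φ : Matrix (Fin m) (Fin m) ℂ →ₗ[ℂ] Matrix (Fin n) (Fin n) ℂ}
    (h : choi φ ∈ decomposableMatrices n m) : IsDecomposable φ := by
  obtain ⟨A, B, hA, hB, hAB⟩ := h
  refine ⟨ofChoi A, ofChoi (ptLeft n m B), isCompletelyPositive_ofChoi hA,
    isCopositive_ofChoi_ptLeft hB, ?_⟩
  ext1 x
  ext i j
  rw [map_apply_eq_sum, hAB]
  simp [ofChoi, mul_add, Finset.sum_add_distrib]

open scoped MatrixOrder Matrix.Norms.L2Operator in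
theorem map_conjTranspose_of_posSemidef {n m : ℕ}
    {φ : Matrix (Fin m) (Fin m) ℂ →ₗ[ℂ] Matrix (Fin n) (Fin n) ℂ}
    (hpos : ∀ b : Matrix (Fin m) (Fin m) ℂ, b.PosSemidef → (φ b).PosSemidef)
    (x : Matrix (Fin m) (Fin m) ℂ) : φ xᴴ = (φ x)ᴴ := by
  have hx : x ∈ Submodule.span ℂ {a : Matrix (Fin m) (Fin m) ℂ | 0 ≤ a} := by
    rw [CStarAlgebra.span_nonneg]; trivial
  induction hx using Submodule.span_induction with
  | mem a ha =>
    have ha' : a.PosSemidef := Matrix.nonneg_iff_posSemidef.1 ha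
    rw [ha'.1.eq, (hpos a ha').1.eq]
  | zero => simp
  | add a b _ _ iha ihb => simp [iha, ihb]
  | smul c a _ ih => simp [Matrix.conjTranspose_smul, ih]

theorem isHermitian_choi {n m : ℕ}
    {φ : Matrix (Fin m) (Fin m) ℂ →ₗ[ℂ] Matrix (Fin n) (Fin n) ℂ}
    (hpos : ∀ b : Matrix (Fin m) (Fin m) ℂ, b.PosSemidef → (φ b).PosSemidef) :
    (choi φ).IsHermitian := by
  ext p q
  have h := map_conjTranspose_of_posSemidef hpos (Matrix.single q.2 p.2 1)
  rw [Matrix.conjTranspose_single, star_one] at h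
  simp [choi, h]

theorem sum_mul_choi_eq {n m : ℕ}
    (φ : Matrix (Fin m) (Fin m) ℂ →ₗ[ℂ] Matrix (Fin n) (Fin n) ℂ)
    (h : Matrix (Fin n × Fin m) (Fin n × Fin m) ℂ) :
    ∑ p, ∑ q, h p q * choi φ p q = ∑ i, ∑ j, mapRight φ h (i, i) (j, j) := by
  simp only [mapRight, Matrix.of_apply, map_apply_eq_sum φ, Fintype.sum_prod_type]
  exact Finset.sum_congr rfl fun i _ => Finset.sum_comm

theorem not_posSemidef_mapRight {n m : ℕ}
    {φ : Matrix (Fin m) (Fin m) ℂ →ₗ[ℂ] Matrix (Fin n) (Fin n) ℂ}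
    {h : Matrix (Fin n × Fin m) (Fin n × Fin m) ℂ}
    (hneg : (∑ p, ∑ q, h p q * choi φ p q).re < 0) : ¬ (mapRight φ h).PosSemidef := fun hp => by
  have hnn := ((hp.submatrix fun i : Fin n => (i, i)).re_dotProduct_nonneg 1)
  rw [sum_mul_choi_eq] at hneg
  simp [dotProduct, Matrix.mulVec] at hnn hneg
  linarith

theorem mapRight_sum_kronecker {n m : ℕ} {ι : Type*} [Fintype ι]
    (φ : Matrix (Fin m) (Fin m) ℂ →ₗ[ℂ] Matrix (Fin n) (Fin n) ℂ)
    (a : ι → Matrix (Fin n) (Fin n) ℂ) (b : ι → Matrix (Fin m) (Fin m) ℂ) :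
    mapRight φ (∑ i, a i ⊗ₖ b i) = ∑ i, a i ⊗ₖ φ (b i) := by
  ext p q
  have : (Matrix.of fun s t => (∑ i, a i ⊗ₖ b i) (p.1, s) (q.1, t)) =
      ∑ i, a i p.1 q.1 • b i := by
    ext s t
    simp [Matrix.sum_apply]
  simp only [mapRight, Matrix.of_apply, this, map_sum, map_smul]
  simp [Matrix.sum_apply]

theorem mapRight_smul {n m : ℕ}
    (φ : Matrix (Fin m) (Fin m) ℂ →ₗ[ℂ] Matrix (Fin n) (Fin n) ℂ) (c : ℂ)
    (h : Matrix (Fin n × Fin m) (Fin n × Fin m) ℂ) :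
    mapRight φ (c • h) = c • mapRight φ h := by
  ext p q
  exact congrFun (congrFun (map_smul φ c (Matrix.of fun s t => h (p.1, s) (q.1, t))) p.2) q.2

/-- A positive nondecomposable map `φ : M_m(ℂ) → M_n(ℂ)` yields a
density matrix `h ∈ M_n(ℂ) ⊗ M_m(ℂ)` such that `(t ⊗ ι)(h)` is positive semidefinite,
`(ι ⊗ φ)(h)` is not positive semidefinite, and the corresponding state is entangled but
satisfies the Peres condition. -/
theorem nondecomposable_gives_entangled_ppt_state (n m : ℕ)
    (φ : Matrix (Fin m) (Fin m) ℂ →ₗ[ℂ] Matrix (Fin n) (Fin n) ℂ)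
    (hpos : ∀ b : Matrix (Fin m) (Fin m) ℂ, b.PosSemidef → (φ b).PosSemidef)
    (hnd : ¬ IsDecomposable φ) :
    ∃ h : Matrix (Fin n × Fin m) (Fin n × Fin m) ℂ,
      h.PosSemidef ∧ h.trace = 1 ∧
      (ptLeft n m h).PosSemidef ∧
      ¬ (mapRight φ h).PosSemidef ∧
      ¬ (∃ (k : ℕ) (a : Fin k → Matrix (Fin n) (Fin n) ℂ)
          (b : Fin k → Matrix (Fin m) (Fin m) ℂ),
          (∀ i, (a i).PosSemidef) ∧ (∀ i, (b i).PosSemidef) ∧ h = ∑ i, a i ⊗ₖ b i) ∧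
      (ptRight n m h).PosSemidef := by
  obtain ⟨h, hh, hpt, hneg⟩ := exists_ppt_re_sum_mul_neg (isHermitian_choi hpos)
    fun hmem => hnd (isDecomposable_of_choi_mem hmem)
  have hmap := not_posSemidef_mapRight hneg
  have htr : h.trace ≠ 0 := fun h0 => by
    rw [hh.trace_eq_zero_iff] at h0
    simp [h0] at hneg
  have hinv : 0 ≤ h.trace⁻¹ := by
    have := hh.trace_nonneg
    exact inv_nonneg.2 this
  have hpt' : (ptLeft n m (h.trace⁻¹ • h)).PosSemidef := hpt.smul hinv
  have hmap' : ¬ (mapRight φ (h.trace⁻¹ • h)).PosSemidef := fun hp => hmap <| by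
    rw [mapRight_smul] at hp
    simpa [smul_smul, htr] using hp.smul hh.trace_nonneg
  refine ⟨h.trace⁻¹ • h, hh.smul hinv, by simp [htr], hpt', hmap', ?_, hpt'.transpose⟩
  rintro ⟨k, a, b, ha, hb, hab⟩
  rw [hab, mapRight_sum_kronecker] at hmap'
  exact hmap' (Matrix.posSemidef_sum _ fun i _ => (ha i).kronecker (hpos _ (hb i)))
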